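/- arXiv:2311.13738 — 2 statements merged into one kernel-verified Lean document; each statement's English description precedes it below -/
import Mathlib

section
/- Perturbed mesa data inherit the adjacency conditions from a smooth function: Let h : [0,1]² → ℝ be continuously differentiable with L-Lipschitz gradient, where L ≤ 1/100, and suppose h(x) ∈ [0.49, 0.51] and ∇h(x) ∈ [−0.001, 0.001]² for all x ∈ [0,1]². Let ℓ = 1/N for some positive integer N, let G = {0, ℓ, 2ℓ, …, 1−ℓ, 1}², and suppose a : G → [0.45, 0.55] satisfies |a(p) − h(p)| ≤ ℓ²/100 for all p ∈ G, and g : G → [−0.01, 0.01]² satisfies ‖2g(p) − ∇h(p)‖_∞ ≤ ℓ/100 for all p ∈ G. Let δ' ≤ ℓ²/100 and, for each p ∈ G and each i ∈ {c, r, t, l, b}, let a_i^p ∈ ℝ satisfy |a_i^p − a(p)| ≤ δ'. Then for all p, p' ∈ G with ‖p − p'‖_∞ ≤ ℓ: (1) ‖g(p) − g(p')‖_∞ ≤ ℓ; (2) for all i, j ∈ {c, r, t, l, b}: a_i^p ∈ [0.4, 0.6] and |a_i^{p'} − a_j^p − ⟨2g(p), p' − p⟩| ≤ ℓ². -/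
noncomputable section

/-- The central affine piece of a mesa. -/
def Pc (p : ℝ × ℝ) (a : ℝ) (g : ℝ × ℝ) (x : ℝ × ℝ) : ℝ :=
  (x.1 - p.1) * g.1 + (x.2 - p.2) * g.2 + a

/-- The right affine piece of a mesa. -/
def Pr (ℓ Γ : ℝ) (p : ℝ × ℝ) (a : ℝ) (g : ℝ × ℝ) (x : ℝ × ℝ) : ℝ :=
  (x.1 - p.1) * (-Γ + g.1) + (x.2 - p.2) * g.2 + a + Γ * ℓ / 2

/-- The top affine piece of a mesa. -/
def Pt (ℓ Γ : ℝ) (p : ℝ × ℝ) (a : ℝ) (g : ℝ × ℝ) (x : ℝ × ℝ) : ℝ :=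
  (x.1 - p.1) * g.1 + (x.2 - p.2) * (-Γ + g.2) + a + Γ * ℓ / 2

/-- The left affine piece of a mesa. -/
def Pl (ℓ Γ : ℝ) (p : ℝ × ℝ) (a : ℝ) (g : ℝ × ℝ) (x : ℝ × ℝ) : ℝ :=
  (x.1 - p.1) * (Γ + g.1) + (x.2 - p.2) * g.2 + a + Γ * ℓ / 2

/-- The bottom affine piece of a mesa. -/
def Pb (ℓ Γ : ℝ) (p : ℝ × ℝ) (a : ℝ) (g : ℝ × ℝ) (x : ℝ × ℝ) : ℝ :=
  (x.1 - p.1) * g.1 + (x.2 - p.2) * (Γ + g.2) + a + Γ * ℓ / 2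

/-- The mesa function with center `p`, values `A` (indexed `0 = c, 1 = r, 2 = t, 3 = l, 4 = b`)
and gradient `g`: the minimum of the five affine pieces. -/
def mesa (ℓ Γ : ℝ) (p : ℝ × ℝ) (A : Fin 5 → ℝ) (g : ℝ × ℝ) (x : ℝ × ℝ) : ℝ :=
  min (Pc p (A 0) g x)
    (min (Pr ℓ Γ p (A 1) g x) (min (Pt ℓ Γ p (A 2) g x) (min (Pl ℓ Γ p (A 3) g x) (Pb ℓ Γ p (A 4) g x))))

/-- The index set of the grid `{0, ℓ, 2ℓ, …, 1}²` where `ℓ = 1/N`. -/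
def grid (N : ℕ) : Finset (ℕ × ℕ) := Finset.range (N + 1) ×ˢ Finset.range (N + 1)

/-- The grid point corresponding to an index pair. -/
def pt (ℓ : ℝ) (k : ℕ × ℕ) : ℝ × ℝ := ((k.1 : ℝ) * ℓ, (k.2 : ℝ) * ℓ)

theorem grid_nonempty (N : ℕ) : (grid N).Nonempty :=
  ⟨(0, 0), by simp [grid]⟩

/-- The unit square `[0,1]²` in `ℝ × ℝ`. -/
def unitSq : Set (ℝ × ℝ) := {x | x.1 ∈ Set.Icc (0 : ℝ) 1 ∧ x.2 ∈ Set.Icc (0 : ℝ) 1}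

/-- The continuous linear functional `w ↦ ⟨v, w⟩` on `ℝ × ℝ` given by a gradient vector `v`. -/
def gradCLM (v : ℝ × ℝ) : ℝ × ℝ →L[ℝ] ℝ :=
  v.1 • (ContinuousLinearMap.fst ℝ ℝ ℝ) + v.2 • (ContinuousLinearMap.snd ℝ ℝ ℝ)

theorem convex_unitSq : Convex ℝ unitSq := by
  have : unitSq = Set.Icc (0 : ℝ) 1 ×ˢ Set.Icc (0 : ℝ) 1 := rfl
  rw [this]
  exact (convex_Icc 0 1).prod (convex_Icc 0 1)

theorem pt_mem_unitSq {N : ℕ} (hN : 0 < N) {k : ℕ × ℕ} (hk : k ∈ grid N) :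
    pt (1 / N) k ∈ unitSq := by
  have hN' : (0 : ℝ) < N := by exact_mod_cast hN
  have key : ∀ m : ℕ, m < N + 1 → (m : ℝ) * (1 / N) ∈ Set.Icc (0 : ℝ) 1 := by
    intro m hm
    have hm' : (m : ℝ) ≤ N := by exact_mod_cast Nat.lt_succ_iff.mp hm
    refine ⟨by positivity, ?_⟩
    rw [mul_one_div]
    exact (div_le_one hN').2 hm'
  simp only [grid, Finset.mem_product, Finset.mem_range] at hk
  exact ⟨key _ hk.1, key _ hk.2⟩

theorem gradCLM_apply (v w : ℝ × ℝ) : gradCLM v w = v.1 * w.1 + v.2 * w.2 := by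
  simp [gradCLM]

theorem norm_gradCLM_sub_le (v w : ℝ × ℝ) : ‖gradCLM v - gradCLM w‖ ≤ 2 * ‖v - w‖ := by
  refine ContinuousLinearMap.opNorm_le_bound _ (by positivity) fun x => ?_
  have hx : (gradCLM v - gradCLM w) x = (v - w).1 * x.1 + (v - w).2 * x.2 := by
    simp only [sub_apply, gradCLM_apply, Prod.fst_sub, Prod.snd_sub]
    ring
  rw [hx]
  calc ‖(v - w).1 * x.1 + (v - w).2 * x.2‖
      ≤ ‖(v - w).1‖ * ‖x.1‖ + ‖(v - w).2‖ * ‖x.2‖ := by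
        simpa only [norm_mul] using norm_add_le ((v - w).1 * x.1) ((v - w).2 * x.2)
    _ ≤ ‖v - w‖ * ‖x‖ + ‖v - w‖ * ‖x‖ := by
        gcongr
        exacts [norm_fst_le _, norm_fst_le _, norm_snd_le _, norm_snd_le _]
    _ = 2 * ‖v - w‖ * ‖x‖ := by ring

/-- First-order Taylor estimate on the unit square for a function with Lipschitz gradient. -/
theorem abs_sub_sub_gradCLM_le {M : ℝ} (hM : 0 ≤ M) {h : ℝ × ℝ → ℝ} {h' : ℝ × ℝ → ℝ × ℝ}
    (hderiv : ∀ x ∈ unitSq, HasFDerivWithinAt h (gradCLM (h' x)) unitSq x)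
    (hlip : ∀ x ∈ unitSq, ∀ y ∈ unitSq, ‖h' x - h' y‖ ≤ M * ‖x - y‖)
    {p q : ℝ × ℝ} (hp : p ∈ unitSq) (hq : q ∈ unitSq) :
    |h q - h p - gradCLM (h' p) (q - p)| ≤ 2 * M * ‖q - p‖ ^ 2 := by
  have hconv : Convex ℝ (unitSq ∩ Metric.closedBall p ‖q - p‖) :=
    convex_unitSq.inter (convex_closedBall _ _)
  have hbound : ∀ x ∈ unitSq ∩ Metric.closedBall p ‖q - p‖,
      ‖gradCLM (h' x) - gradCLM (h' p)‖ ≤ 2 * (M * ‖q - p‖) := by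
    rintro x ⟨hx, hxp⟩
    rw [mem_closedBall_iff_norm] at hxp
    calc ‖gradCLM (h' x) - gradCLM (h' p)‖ ≤ 2 * ‖h' x - h' p‖ := norm_gradCLM_sub_le _ _
      _ ≤ 2 * (M * ‖x - p‖) := by gcongr; exact hlip x hx p hp
      _ ≤ 2 * (M * ‖q - p‖) := by gcongr
  have := hconv.norm_image_sub_le_of_norm_hasFDerivWithin_le'
    (fun x hx => (hderiv x hx.1).mono Set.inter_subset_left) hbound
    ⟨hp, by simp⟩ ⟨hq, mem_closedBall_iff_norm.2 le_rfl⟩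
  rw [Real.norm_eq_abs] at this
  linarith

/-- Perturbed mesa data inherit the adjacency conditions from a smooth function.
Here `h' : ℝ × ℝ → ℝ × ℝ` is the gradient of `h` on the unit square, and the norm
on `ℝ × ℝ` is the sup-norm. -/
theorem perturbed_mesa_data_adjacency
    (L : ℝ) (hL : L ≤ 1 / 100)
    (h : ℝ × ℝ → ℝ) (h' : ℝ × ℝ → ℝ × ℝ)
    (hderiv : ∀ x ∈ unitSq, HasFDerivWithinAt h (gradCLM (h' x)) unitSq x)
    (hlip : ∀ x ∈ unitSq, ∀ y ∈ unitSq, ‖h' x - h' y‖ ≤ L * ‖x - y‖)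
    (hval : ∀ x ∈ unitSq, h x ∈ Set.Icc (0.49 : ℝ) 0.51)
    (hgrad : ∀ x ∈ unitSq,
      (h' x).1 ∈ Set.Icc (-0.001 : ℝ) 0.001 ∧ (h' x).2 ∈ Set.Icc (-0.001 : ℝ) 0.001)
    (N : ℕ) (hN : 0 < N) (ℓ : ℝ) (hℓ : ℓ = 1 / N)
    (a : ℕ × ℕ → ℝ)
    (ha : ∀ k ∈ grid N, a k ∈ Set.Icc (0.45 : ℝ) 0.55 ∧ |a k - h (pt ℓ k)| ≤ ℓ ^ 2 / 100)
    (g : ℕ × ℕ → ℝ × ℝ)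
    (hg : ∀ k ∈ grid N,
      ((g k).1 ∈ Set.Icc (-0.01 : ℝ) 0.01 ∧ (g k).2 ∈ Set.Icc (-0.01 : ℝ) 0.01) ∧
      ‖(2 * (g k).1, 2 * (g k).2) - h' (pt ℓ k)‖ ≤ ℓ / 100)
    (δ' : ℝ) (hδ' : δ' ≤ ℓ ^ 2 / 100)
    (A : ℕ × ℕ → Fin 5 → ℝ) (hA : ∀ k ∈ grid N, ∀ i, |A k i - a k| ≤ δ') :
    ∀ k ∈ grid N, ∀ k' ∈ grid N, ‖pt ℓ k - pt ℓ k'‖ ≤ ℓ →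
      ‖g k - g k'‖ ≤ ℓ ∧
      ∀ i j : Fin 5, A k i ∈ Set.Icc (0.4 : ℝ) 0.6 ∧
        |A k' i - A k j
          - (2 * (g k).1 * ((pt ℓ k').1 - (pt ℓ k).1)
             + 2 * (g k).2 * ((pt ℓ k').2 - (pt ℓ k).2))| ≤ ℓ ^ 2 := by
  intro k hk k' hk' hkk
  have hN' : (1 : ℝ) ≤ N := by exact_mod_cast hN
  have hℓ0 : 0 ≤ ℓ := by rw [hℓ]; positivity
  have hℓ1 : ℓ ≤ 1 := by
    rw [hℓ]
    exact (div_le_one (by linarith)).2 hN'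
  have hℓsq : ℓ ^ 2 ≤ 1 := pow_le_one₀ hℓ0 hℓ1
  have hp : pt ℓ k ∈ unitSq := by rw [hℓ]; exact pt_mem_unitSq hN hk
  have hp' : pt ℓ k' ∈ unitSq := by rw [hℓ]; exact pt_mem_unitSq hN hk'
  have hlip' : ∀ x ∈ unitSq, ∀ y ∈ unitSq, ‖h' x - h' y‖ ≤ 1 / 100 * ‖x - y‖ := fun x hx y hy =>
    (hlip x hx y hy).trans (by gcongr)
  have htaylor := abs_sub_sub_gradCLM_le (by norm_num) hderiv hlip' hp hp'
  have hgl := (hlip' _ hp _ hp').trans (mul_le_mul_of_nonneg_left hkk (by norm_num))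
  have hgk := (hg k hk).2
  have hgk' := (hg k' hk').2
  have hak := ha k hk
  have hak' := ha k' hk'
  rw [norm_sub_rev] at hkk
  have hsq : ‖pt ℓ k' - pt ℓ k‖ ^ 2 ≤ ℓ ^ 2 := by gcongr
  rw [gradCLM_apply] at htaylor
  simp only [Prod.norm_def, Prod.fst_sub, Prod.snd_sub, Real.norm_eq_abs, sup_le_iff]
    at hgl hgk hgk' hkk htaylor ⊢
  refine ⟨⟨?_, ?_⟩, fun i j => ⟨?_, ?_⟩⟩
  · simp only [abs_le] at *
    constructor <;> linarith
  · simp only [abs_le] at *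
    constructor <;> linarith
  · have hAi := abs_le.1 (hA k hk i)
    have h1 := hak.1.1
    have h2 := hak.1.2
    constructor <;> norm_num at h1 h2 ⊢ <;> linarith
  · have hAi := abs_le.1 (hA k' hk' i)
    have hAj := abs_le.1 (hA k hk j)
    have e1 : |(2 * (g k).1 - (h' (pt ℓ k)).1) * ((pt ℓ k').1 - (pt ℓ k).1)| ≤ ℓ / 100 * ℓ := by
      rw [abs_mul]
      exact mul_le_mul hgk.1 hkk.1 (abs_nonneg _) (by positivity)
    have e2 : |(2 * (g k).2 - (h' (pt ℓ k)).2) * ((pt ℓ k').2 - (pt ℓ k).2)| ≤ ℓ / 100 * ℓ := by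
      rw [abs_mul]
      exact mul_le_mul hgk.2 hkk.2 (abs_nonneg _) (by positivity)
    have h1 := abs_le.1 hak.2
    have h2 := abs_le.1 hak'.2
    simp only [Prod.norm_def, Prod.fst_sub, Prod.snd_sub, Real.norm_eq_abs] at hsq
    rw [abs_le] at e1 e2 htaylor ⊢
    constructor <;> nlinarith
end
end

section
/- Reduction of general linear arithmetic circuits to circuits with only [0,1]-truncation gates, respecting perturbations: Let C be an arithmetic circuit with n inputs and one output whose gates are of the types addition, subtraction, real constants, multiplication by a real constant, binary min, binary max, and truncation trunc_{[a,b]} to an interval [a,b], and whose output gate is a trunc_{[0,1]} gate. Then there exist a real number K > 0 and an arithmetic circuit C̄ with the same number of inputs and one output, all of whose gates are of the form x_i = trunc_{[0,1]}(a·x_j + b·x_k + c), such that for every δ ≤ 1/K and every perturbation vector π of C̄ with all entries in [−δ, δ], there exists a perturbation vector σ of C with all entries in [−δK, δK] satisfying f^σ(y) = f̄^π(y) for all y ∈ [0,1]ⁿ, where f^σ and f̄^π denote the functions computed by the perturbed circuits C^σ and C̄^π respectively. -/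
noncomputable section

/-- Truncation to the interval `[lo, hi]`. -/
def truncTo (lo hi z : ℝ) : ℝ := min hi (max lo z)

/-- A gate of a general linear arithmetic circuit: addition, subtraction, a real constant,
multiplication by a real constant, binary min, binary max, or truncation of an affine
combination to an interval `[lo, hi]` (`ctr lo hi a b c j k` computes
`trunc_{[lo,hi]}(a·x_j + b·x_k + c)`). -/
inductive CGate where
  | add : ℕ → ℕ → CGate
  | sub : ℕ → ℕ → CGate
  | const : ℝ → CGate
  | smul : ℝ → ℕ → CGate
  | cmin : ℕ → ℕ → CGate
  | cmax : ℕ → ℕ → CGate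
  | ctr : ℝ → ℝ → ℝ → ℝ → ℝ → ℕ → ℕ → CGate

/-- Well-formedness of the gate computing variable `i`: it only refers to earlier variables. -/
def CGate.wf : CGate → ℕ → Prop
  | .add j k, i => j < i ∧ k < i
  | .sub j k, i => j < i ∧ k < i
  | .const _, _ => True
  | .smul _ j, i => j < i
  | .cmin j k, i => j < i ∧ k < i
  | .cmax j k, i => j < i ∧ k < i
  | .ctr _ _ _ _ _ j k, i => j < i ∧ k < i

/-- The value of variable `i` of the general circuit perturbed by `σ`: variables with index
`≤ n` are inputs; min/max gates have the perturbation added to their second argument and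
truncation gates have it added inside the truncation.  (Out-of-order references default
to `0`; they never occur in well-formed circuits.) -/
def evalC (n : ℕ) (gate : ℕ → CGate) (σ : ℕ → ℝ) (inp : ℕ → ℝ) (i : ℕ) : ℝ :=
  if i ≤ n then inp i
  else
    match gate i with
    | .add j k =>
        (if _ : j < i then evalC n gate σ inp j else 0)
          + (if _ : k < i then evalC n gate σ inp k else 0)
    | .sub j k =>
        (if _ : j < i then evalC n gate σ inp j else 0)
          - (if _ : k < i then evalC n gate σ inp k else 0)
    | .const a => a
    | .smul a j => a * (if _ : j < i then evalC n gate σ inp j else 0)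
    | .cmin j k =>
        min (if _ : j < i then evalC n gate σ inp j else 0)
          ((if _ : k < i then evalC n gate σ inp k else 0) + σ i)
    | .cmax j k =>
        max (if _ : j < i then evalC n gate σ inp j else 0)
          ((if _ : k < i then evalC n gate σ inp k else 0) + σ i)
    | .ctr lo hi a b cc j k =>
        truncTo lo hi (a * (if _ : j < i then evalC n gate σ inp j else 0)
          + b * (if _ : k < i then evalC n gate σ inp k else 0) + cc + σ i)
termination_by i
decreasing_by all_goals omega

/-- The value of variable `i` of a circuit all of whose gates are of the form
`x_i = trunc_{[0,1]}(A_i·x_{J i} + B_i·x_{K i} + C_i)`, perturbed by `π`. -/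
def evalBar (n : ℕ) (A B C : ℕ → ℝ) (J K : ℕ → ℕ) (π : ℕ → ℝ) (inp : ℕ → ℝ) (i : ℕ) : ℝ :=
  if i ≤ n then inp i
  else
    truncTo 0 1 (A i * (if _ : J i < i then evalBar n A B C J K π inp (J i) else 0)
      + B i * (if _ : K i < i then evalBar n A B C J K π inp (K i) else 0) + C i + π i)
termination_by i
decreasing_by all_goals omega

/-- The inputs `1, …, n` lie in the unit interval. -/
def UnitInputs (n : ℕ) (inp : ℕ → ℝ) : Prop :=
  ∀ i, 1 ≤ i → i ≤ n → inp i ∈ Set.Icc (0 : ℝ) 1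

/-! ### Truncation -/

theorem truncTo_mem_Icc {lo hi : ℝ} (h : lo ≤ hi) (z : ℝ) : truncTo lo hi z ∈ Set.Icc lo hi :=
  ⟨le_min h (le_max_left _ _), min_le_left _ _⟩

theorem truncTo_of_mem_Icc {lo hi z : ℝ} (h₁ : lo ≤ z) (h₂ : z ≤ hi) : truncTo lo hi z = z := by
  rw [truncTo, max_eq_right h₁, min_eq_right h₂]

theorem truncTo_of_hi_le_lo {lo hi : ℝ} (h : hi ≤ lo) (z : ℝ) : truncTo lo hi z = hi :=
  min_eq_left (h.trans (le_max_left _ _))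

theorem truncTo_of_hi_le {lo hi z : ℝ} (h : hi ≤ z) : truncTo lo hi z = hi :=
  min_eq_left (h.trans (le_max_right _ _))

theorem truncTo_of_le_lo {lo hi z : ℝ} (h : lo ≤ hi) (hz : z ≤ lo) : truncTo lo hi z = lo := by
  rw [truncTo, max_eq_left hz, min_eq_right h]

theorem truncTo_of_le_hi {lo hi z : ℝ} (h : lo ≤ hi) (hz : z ≤ hi) :
    truncTo lo hi z = max lo z := min_eq_right (max_le h hz)

theorem rescale_truncTo {lo hi : ℝ} (h : lo < hi) (z : ℝ) :
    (hi - lo) * truncTo 0 1 ((z - lo) / (hi - lo)) + lo = truncTo lo hi z := by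
  have hd : 0 < hi - lo := sub_pos.2 h
  unfold truncTo
  rw [mul_min_of_nonneg _ _ hd.le, mul_max_of_nonneg _ _ hd.le, mul_div_cancel₀ _ hd.ne',
    ← min_add_add_right, ← max_add_add_right]
  simp

/-! ### Gates of the general circuit -/

/-- The value of a gate perturbed by `s` when the variables have values `x`. -/
def CGate.val (s : ℝ) (x : ℕ → ℝ) : CGate → ℝ
  | .add j k => x j + x k
  | .sub j k => x j - x k
  | .const a => a
  | .smul a j => a * x j
  | .cmin j k => min (x j) (x k + s)
  | .cmax j k => max (x j) (x k + s)
  | .ctr lo hi a b c j k => truncTo lo hi (a * x j + b * x k + c + s)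

theorem CGate.val_congr {g : CGate} {i : ℕ} (hg : g.wf i) (s : ℝ) {x y : ℕ → ℝ}
    (h : ∀ j < i, x j = y j) : g.val s x = g.val s y := by
  cases g <;> simp only [CGate.wf] at hg <;> simp only [CGate.val]
  case smul => rw [h _ hg]
  all_goals rw [h _ hg.1, h _ hg.2]

theorem evalC_of_le {n i : ℕ} (h : i ≤ n) (gate : ℕ → CGate) (σ inp : ℕ → ℝ) :
    evalC n gate σ inp i = inp i := by
  rw [evalC, if_pos h]

theorem evalC_of_lt {n i : ℕ} {gate : ℕ → CGate} (h : n < i) (hwf : (gate i).wf i)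
    (σ inp : ℕ → ℝ) :
    evalC n gate σ inp i = (gate i).val (σ i) (evalC n gate σ inp) := by
  rw [evalC, if_neg (not_le.2 h)]
  generalize gate i = g at hwf
  cases g <;> simp only [CGate.wf] at hwf <;> simp [CGate.val, hwf]

theorem evalC_congr {n N : ℕ} {gate : ℕ → CGate} (hwf : ∀ i, n < i → i ≤ N → (gate i).wf i)
    {σ σ' : ℕ → ℝ} {m : ℕ} (hm : m ≤ N) (h : ∀ i ≤ m, σ i = σ' i) (inp : ℕ → ℝ) :
    ∀ i ≤ m, evalC n gate σ inp i = evalC n gate σ' inp i := by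
  intro i
  induction i using Nat.strong_induction_on with
  | _ i ih =>
    intro him
    rcases le_or_gt i n with hi | hi
    · rw [evalC_of_le hi, evalC_of_le hi]
    · have hg := hwf i hi (him.trans hm)
      rw [evalC_of_lt hi hg, evalC_of_lt hi hg, h i him]
      exact CGate.val_congr hg _ fun j hj => ih j hj (hj.le.trans him)

/-- A constant offset on the arguments of a gate amounts to a perturbation of the gate together
with a constant offset on its value. -/
theorem CGate.exists_val_add_offset (g : CGate) :
    ∃ c : ℝ, 0 ≤ c ∧ ∀ (ε : ℝ) (e : ℕ → ℝ) (q : ℝ), (∀ i, |e i| ≤ ε) → |q| ≤ ε →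
      ∃ s t : ℝ, |s| ≤ c * ε ∧ |t| ≤ c * ε ∧
        ∀ x : ℕ → ℝ, g.val q (fun i => x i + e i) = t + g.val s x := by
  have minmax : ∀ {ε q : ℝ} {e : ℕ → ℝ} (j k : ℕ), (∀ i, |e i| ≤ ε) → |q| ≤ ε →
      |e k + q - e j| ≤ 3 * ε ∧ |e j| ≤ 3 * ε := by
    intro ε q e j k he hq
    have hj := abs_le.1 (he j)
    have hk := abs_le.1 (he k)
    have hq := abs_le.1 hq
    constructor <;> rw [abs_le] <;> constructor <;> linarith
  cases g with
  | add j k =>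
    refine ⟨2, by norm_num, fun ε e q he hq => ⟨0, e j + e k, ?_, ?_, fun x => ?_⟩⟩
    · simpa using (abs_nonneg _).trans hq
    · linarith [abs_add_le (e j) (e k), he j, he k]
    · simp only [CGate.val]; ring
  | sub j k =>
    refine ⟨2, by norm_num, fun ε e q he hq => ⟨0, e j - e k, ?_, ?_, fun x => ?_⟩⟩
    · simpa using (abs_nonneg _).trans hq
    · linarith [abs_sub (e j) (e k), he j, he k]
    · simp only [CGate.val]; ring
  | const a =>
    exact ⟨0, le_rfl, fun ε e q he hq => ⟨0, 0, by simp, by simp, fun x => by simp [CGate.val]⟩⟩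
  | smul a j =>
    refine ⟨|a|, abs_nonneg a, fun ε e q he hq => ⟨0, a * e j, ?_, ?_, fun x => ?_⟩⟩
    · simpa using mul_nonneg (abs_nonneg a) ((abs_nonneg _).trans hq)
    · rw [abs_mul]
      exact mul_le_mul_of_nonneg_left (he j) (abs_nonneg a)
    · simp only [CGate.val]; ring
  | cmin j k =>
    refine ⟨3, by norm_num, fun ε e q he hq => ⟨e k + q - e j, e j, (minmax j k he hq).1,
      (minmax j k he hq).2, fun x => ?_⟩⟩
    simp only [CGate.val]
    rw [← min_add_add_left]
    congr 1 <;> ring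
  | cmax j k =>
    refine ⟨3, by norm_num, fun ε e q he hq => ⟨e k + q - e j, e j, (minmax j k he hq).1,
      (minmax j k he hq).2, fun x => ?_⟩⟩
    simp only [CGate.val]
    rw [← max_add_add_left]
    congr 1 <;> ring
  | ctr lo hi a b c j k =>
    refine ⟨|a| + |b| + 1, by positivity, fun ε e q he hq =>
      ⟨a * e j + b * e k + q, 0, ?_, ?_, fun x => ?_⟩⟩
    · have h₁ : |a * e j| ≤ |a| * ε := by
        rw [abs_mul]; exact mul_le_mul_of_nonneg_left (he j) (abs_nonneg a)
      have h₂ : |b * e k| ≤ |b| * ε := by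
        rw [abs_mul]; exact mul_le_mul_of_nonneg_left (he k) (abs_nonneg b)
      linarith [abs_add_three (a * e j) (b * e k) q]
    · have := (abs_nonneg _).trans hq
      rw [abs_zero]; positivity
    · simp only [CGate.val, zero_add]
      congr 1; ring

/-! ### Dependence on the unrestricted variable `x₀` -/

/-- Beyond a uniform threshold, every member of the family `F` is affine in its real argument,
with a common slope and uniformly bounded intercepts. -/
def EventuallyAffine {ι : Type*} (F : ι → ℝ → ℝ) : Prop :=
  ∃ (α M R : ℝ) (g : ι → ℝ), ∀ p, |g p| ≤ R ∧ ∀ t, M ≤ t → F p t = α * t + g p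

namespace EventuallyAffine

variable {ι : Type*} {F G : ι → ℝ → ℝ}

theorem of_bounded {f : ι → ℝ} {R : ℝ} (h : ∀ p, |f p| ≤ R) :
    EventuallyAffine fun p _ => f p :=
  ⟨0, 0, R, f, fun p => ⟨h p, fun t _ => by simp⟩⟩

theorem const (c : ℝ) : EventuallyAffine fun (_ : ι) _ => c :=
  of_bounded fun _ => le_rfl

theorem linear (c : ℝ) : EventuallyAffine fun (_ : ι) t => c * t :=
  ⟨c, 0, 0, fun _ => 0, fun _ => by simp⟩

theorem add (hF : EventuallyAffine F) (hG : EventuallyAffine G) :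
    EventuallyAffine fun p t => F p t + G p t := by
  obtain ⟨α, M, R, f, hf⟩ := hF
  obtain ⟨β, L, S, g, hg⟩ := hG
  refine ⟨α + β, max M L, R + S, fun p => f p + g p, fun p => ⟨?_, fun t ht => ?_⟩⟩
  · exact (abs_add_le _ _).trans (add_le_add (hf p).1 (hg p).1)
  · beta_reduce
    rw [(hf p).2 t ((le_max_left _ _).trans ht), (hg p).2 t ((le_max_right _ _).trans ht)]
    ring

theorem smul (c : ℝ) (hF : EventuallyAffine F) : EventuallyAffine fun p t => c * F p t := by
  obtain ⟨α, M, R, f, hf⟩ := hF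
  refine ⟨c * α, M, |c| * R, fun p => c * f p, fun p => ⟨?_, fun t ht => ?_⟩⟩
  · rw [abs_mul]
    exact mul_le_mul_of_nonneg_left (hf p).1 (abs_nonneg c)
  · beta_reduce
    rw [(hf p).2 t ht]
    ring

theorem min (hF : EventuallyAffine F) (hG : EventuallyAffine G) :
    EventuallyAffine fun p t => min (F p t) (G p t) := by
  wlog h : hF.choose ≤ hG.choose generalizing F G
  · simpa only [min_comm] using this hG hF (le_of_not_ge h)
  obtain ⟨M, R, f, hf⟩ := hF.choose_spec
  obtain ⟨L, S, g, hg⟩ := hG.choose_spec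
  generalize hF.choose = α at *
  generalize hG.choose = β at *
  rcases h.eq_or_lt with rfl | h
  · refine ⟨α, max M L, max R S, fun p => Min.min (f p) (g p), fun p => ⟨?_, fun t ht => ?_⟩⟩
    · exact abs_min_le_max_abs_abs.trans (max_le_max (hf p).1 (hg p).1)
    · beta_reduce
      rw [(hf p).2 t ((le_max_left _ _).trans ht), (hg p).2 t ((le_max_right _ _).trans ht),
        min_add_add_left]
  · refine ⟨α, max (max M L) ((R + S) / (β - α)), R, f, fun p => ⟨(hf p).1, fun t ht => ?_⟩⟩
    simp only [max_le_iff] at ht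
    have hd := (div_le_iff₀ (sub_pos.2 h)).1 ht.2
    have h₁ := abs_le.1 (hf p).1
    have h₂ := abs_le.1 (hg p).1
    beta_reduce
    rw [(hf p).2 t ht.1.1, (hg p).2 t ht.1.2, min_eq_left]
    linarith

theorem max (hF : EventuallyAffine F) (hG : EventuallyAffine G) :
    EventuallyAffine fun p t => max (F p t) (G p t) := by
  have h := ((hF.smul (-1)).min (hG.smul (-1))).smul (-1)
  simpa only [neg_one_mul, min_neg_neg, neg_neg] using h

theorem exists_eq_of_bounded (hF : EventuallyAffine F) {B : ℝ} (hB : ∀ p t, |F p t| ≤ B) :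
    ∃ M : ℝ, ∀ p t t', M ≤ t → M ≤ t' → F p t = F p t' := by
  obtain ⟨α, M, R, f, hf⟩ := hF
  rcases isEmpty_or_nonempty ι with hι | ⟨⟨p₀⟩⟩
  · exact ⟨0, fun p => hι.elim p⟩
  have hα : α = 0 := by
    by_contra hne
    set t := Max.max M ((B + R + 1) / |α|)
    have h₁ : B + R + 1 ≤ |α| * t := by
      rw [mul_comm]
      exact (div_le_iff₀ (abs_pos.2 hne)).1 (le_max_right _ _)
    have h₂ : |α| * t ≤ |α * t| := by
      rw [abs_mul]
      exact mul_le_mul_of_nonneg_left (le_abs_self t) (abs_nonneg α)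
    have h₃ : α * t = F p₀ t - f p₀ := by
      rw [(hf p₀).2 t (le_max_left _ _)]; ring
    have h₄ := abs_sub (F p₀ t) (f p₀)
    rw [← h₃] at h₄
    linarith [hB p₀ t, (hf p₀).1]
  refine ⟨M, fun p t t' ht ht' => ?_⟩
  rw [(hf p).2 t ht, (hf p).2 t' ht', hα, zero_mul, zero_mul]

theorem val {g : CGate} {i : ℕ} (hg : g.wf i) {s : ι → ℝ} (hs : ∀ p, |s p| ≤ 1)
    {x : ι → ℝ → ℕ → ℝ} (hx : ∀ j < i, EventuallyAffine fun p t => x p t j) :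
    EventuallyAffine fun p t => g.val (s p) (x p t) := by
  have hs := of_bounded hs
  cases g with
  | add j k => exact (hx j hg.1).add (hx k hg.2)
  | sub j k =>
    simpa only [CGate.val, neg_one_mul, sub_eq_add_neg] using
      (hx j hg.1).add ((hx k hg.2).smul (-1))
  | const a => exact const a
  | smul a j => exact (hx j hg).smul a
  | cmin j k => exact (hx j hg.1).min ((hx k hg.2).add hs)
  | cmax j k => exact (hx j hg.1).max ((hx k hg.2).add hs)
  | ctr lo hi a b c j k =>
    exact (const hi).min ((const lo).max
      (((((hx j hg.1).smul a).add ((hx k hg.2).smul b)).add (const c)).add hs))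

end EventuallyAffine

theorem eventuallyAffine_evalC {n N : ℕ} {gate : ℕ → CGate}
    (hwf : ∀ i, n < i → i ≤ N → (gate i).wf i) (τ : ℝ) (i : ℕ) (hiN : i ≤ N) :
    EventuallyAffine
      fun (p : {p : (ℕ → ℝ) × (ℕ → ℝ) // (∀ i, |p.1 i| ≤ 1) ∧ UnitInputs n p.2}) t =>
        evalC n gate p.1.1 (Function.update p.1.2 0 (τ * t)) i := by
  induction i using Nat.strong_induction_on with
  | _ i ih =>
    rcases le_or_gt i n with hi | hi
    · simp only [evalC_of_le hi]
      rcases Nat.eq_zero_or_pos i with rfl | hpos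
      · simpa using EventuallyAffine.linear τ
      · simp only [Function.update_of_ne hpos.ne']
        refine EventuallyAffine.of_bounded (R := 1) fun p => ?_
        have := p.2.2 i hpos hi
        rw [abs_of_nonneg this.1]
        exact this.2
    · have hg := hwf i hi hiN
      simp only [evalC_of_lt hi hg]
      exact EventuallyAffine.val hg (fun p => p.2.1 i) fun j hj => ih j hj (hj.le.trans hiN)

/-- Input `x₀` is shifted by `e`, clamped to `[-M, M]` and shifted back. -/
def clampZero (M e : ℝ) (inp : ℕ → ℝ) : ℕ → ℝ :=
  Function.update inp 0 (truncTo (-M) M (inp 0 + e) - e)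

/-- A bounded output does not notice that `x₀` is clamped to a sufficiently large interval. -/
theorem exists_evalC_clampZero_eq {n N : ℕ} {gate : ℕ → CGate}
    (hwf : ∀ i, n < i → i ≤ N → (gate i).wf i) {B : ℝ}
    (hB : ∀ σ inp, |evalC n gate σ inp N| ≤ B) :
    ∃ M : ℝ, 0 < M ∧ ∀ σ : ℕ → ℝ, (∀ i, |σ i| ≤ 1) → ∀ e : ℝ, |e| ≤ 1 →
      ∀ inp, UnitInputs n inp →
        evalC n gate σ (clampZero M e inp) N = evalC n gate σ inp N := by
  obtain ⟨M₁, h₁⟩ := (eventuallyAffine_evalC hwf 1 N le_rfl).exists_eq_of_bounded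
    fun p t => hB _ _
  obtain ⟨M₂, h₂⟩ := (eventuallyAffine_evalC hwf (-1) N le_rfl).exists_eq_of_bounded
    fun p t => hB _ _
  have hM₁ : M₁ ≤ max M₁ M₂ := le_max_left _ _
  have hM₂ : M₂ ≤ max M₁ M₂ := le_max_right _ _
  set M₀ := max M₁ M₂
  have hM₀ : M₀ ≤ |M₀| := le_abs_self _
  have hpos : 0 ≤ |M₀| := abs_nonneg _
  refine ⟨|M₀| + 1, by linarith, fun σ hσ e he inp hinp => ?_⟩
  have he := abs_le.1 he
  have hself : Function.update inp 0 (inp 0) = inp := Function.update_eq_self 0 inp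
  rcases le_total (|M₀| + 1) (inp 0 + e) with hx | hx
  · have h := h₁ ⟨(σ, inp), hσ, hinp⟩ (|M₀| + 1 - e) (inp 0) (by linarith) (by linarith)
    simp only [one_mul, hself] at h
    rw [clampZero, truncTo_of_hi_le hx, h]
  rcases le_total (inp 0 + e) (-(|M₀| + 1)) with hx' | hx'
  · have h := h₂ ⟨(σ, inp), hσ, hinp⟩ (|M₀| + 1 + e) (-inp 0) (by linarith) (by linarith)
    simp only [neg_one_mul, neg_neg, hself] at h
    rw [clampZero, truncTo_of_le_lo (by linarith) hx', ← h]
    congr 2; ring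
  · rw [clampZero, truncTo_of_mem_Icc hx' hx, add_sub_cancel_right, hself]

/-! ### Circuits of `[0,1]`-truncation gates -/

/-- A circuit all of whose gates truncate to `[0,1]`, with last variable `N`. -/
structure BarCircuit where
  N : ℕ
  A : ℕ → ℝ
  B : ℕ → ℝ
  C : ℕ → ℝ
  J : ℕ → ℕ
  K : ℕ → ℕ

/-- An affine function `scale · x_idx + shift` of one variable of a circuit. -/
structure Readout where
  idx : ℕ
  scale : ℝ
  shift : ℝ

namespace BarCircuit

/-- Every gate refers to earlier variables only. -/
def WF (n : ℕ) (Γ : BarCircuit) : Prop :=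
  ∀ i, n < i → i ≤ Γ.N → Γ.J i < i ∧ Γ.K i < i

/-- The value of variable `i` under the perturbation `π`. -/
def eval (n : ℕ) (Γ : BarCircuit) (π inp : ℕ → ℝ) (i : ℕ) : ℝ :=
  evalBar n Γ.A Γ.B Γ.C Γ.J Γ.K π inp i

/-- The value of a readout. -/
def read (n : ℕ) (Γ : BarCircuit) (R : Readout) (π inp : ℕ → ℝ) : ℝ :=
  R.scale * Γ.eval n π inp R.idx + R.shift

/-- `Γ'` is a well-formed circuit obtained from `Γ` by appending gates. -/
structure Extends (n : ℕ) (Γ Γ' : BarCircuit) : Prop where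
  wf : Γ'.WF n
  le : Γ.N ≤ Γ'.N
  eval_eq : ∀ π inp, ∀ i ≤ Γ.N, Γ'.eval n π inp i = Γ.eval n π inp i

/-- The readout refers to a variable of `Γ` other than `x₀`. -/
def Bounded (Γ : BarCircuit) (R : Readout) : Prop := 1 ≤ R.idx ∧ R.idx ≤ Γ.N

variable {n : ℕ} {Γ Γ' Γ'' : BarCircuit} {R R₁ R₂ : Readout}

theorem Extends.trans (h : Extends n Γ Γ') (h' : Extends n Γ' Γ'') : Extends n Γ Γ'' where
  wf := h'.wf
  le := h.le.trans h'.le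
  eval_eq π inp i hi := by rw [h'.eval_eq π inp i (hi.trans h.le), h.eval_eq π inp i hi]

theorem Extends.read_eq (h : Extends n Γ Γ') (hR : R.idx ≤ Γ.N) (π inp : ℕ → ℝ) :
    Γ'.read n R π inp = Γ.read n R π inp := by
  rw [read, read, h.eval_eq π inp _ hR]

theorem Extends.bounded (h : Extends n Γ Γ') (hR : Γ.Bounded R) : Γ'.Bounded R :=
  ⟨hR.1, hR.2.trans h.le⟩

theorem eval_of_le {i : ℕ} (h : i ≤ n) (π inp : ℕ → ℝ) : Γ.eval n π inp i = inp i := by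
  rw [eval, evalBar, if_pos h]

theorem eval_of_lt {i : ℕ} (h : n < i) (hJ : Γ.J i < i) (hK : Γ.K i < i) (π inp : ℕ → ℝ) :
    Γ.eval n π inp i = truncTo 0 1 (Γ.A i * Γ.eval n π inp (Γ.J i)
      + Γ.B i * Γ.eval n π inp (Γ.K i) + Γ.C i + π i) := by
  rw [eval, evalBar, if_neg (not_le.2 h), dif_pos hJ, dif_pos hK]
  rfl

theorem eval_mem_Icc {inp : ℕ → ℝ} (hinp : UnitInputs n inp) (π : ℕ → ℝ) {i : ℕ} (hi : 1 ≤ i) :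
    Γ.eval n π inp i ∈ Set.Icc (0 : ℝ) 1 := by
  rcases le_or_gt i n with h | h
  · rw [eval_of_le h]
    exact hinp i hi h
  · rw [eval, evalBar, if_neg (not_le.2 h)]
    exact truncTo_mem_Icc zero_le_one _

theorem abs_read_le {inp : ℕ → ℝ} (hinp : UnitInputs n inp) (π : ℕ → ℝ) (hR : 1 ≤ R.idx) :
    |Γ.read n R π inp| ≤ |R.scale| + |R.shift| := by
  have h := eval_mem_Icc (Γ := Γ) hinp π hR
  refine (abs_add_le _ _).trans (add_le_add_left ?_ _)
  rw [abs_mul, abs_of_nonneg h.1]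
  exact mul_le_of_le_one_right (abs_nonneg _) h.2

/-- The circuit with one more gate. -/
def push (Γ : BarCircuit) (a b c : ℝ) (j k : ℕ) : BarCircuit where
  N := Γ.N + 1
  A := Function.update Γ.A (Γ.N + 1) a
  B := Function.update Γ.B (Γ.N + 1) b
  C := Function.update Γ.C (Γ.N + 1) c
  J := Function.update Γ.J (Γ.N + 1) j
  K := Function.update Γ.K (Γ.N + 1) k

theorem extends_push (hΓ : Γ.WF n) (a b c : ℝ) {j k : ℕ} (hj : j ≤ Γ.N) (hk : k ≤ Γ.N) :
    Extends n Γ (Γ.push a b c j k) where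
  wf i hni hi := by
    rcases Nat.lt_or_ge Γ.N i with h | h
    · obtain rfl : i = Γ.N + 1 := le_antisymm hi h
      simp only [push, Function.update_self]
      omega
    · have hne : i ≠ Γ.N + 1 := by omega
      simpa only [push, Function.update_of_ne hne] using hΓ i hni h
  le := Nat.le_succ _
  eval_eq π inp i := by
    induction i using Nat.strong_induction_on with
    | _ i ih =>
      intro hi
      rcases le_or_gt i n with h | h
      · rw [eval_of_le h, eval_of_le h]
      · have hne : i ≠ Γ.N + 1 := by omega
        obtain ⟨hJ, hK⟩ := hΓ i h hi
        have hJ' : (Γ.push a b c j k).J i = Γ.J i := Function.update_of_ne hne _ _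
        have hK' : (Γ.push a b c j k).K i = Γ.K i := Function.update_of_ne hne _ _
        rw [eval_of_lt h (hJ' ▸ hJ) (hK' ▸ hK), eval_of_lt h hJ hK, hJ', hK',
          ih _ hJ (hJ.le.trans hi), ih _ hK (hK.le.trans hi)]
        simp only [push, Function.update_of_ne hne]

theorem eval_push (hΓ : Γ.WF n) (hn : n ≤ Γ.N) (a b c : ℝ) {j k : ℕ} (hj : j ≤ Γ.N)
    (hk : k ≤ Γ.N) (π inp : ℕ → ℝ) :
    (Γ.push a b c j k).eval n π inp (Γ.N + 1) =
      truncTo 0 1 (a * Γ.eval n π inp j + b * Γ.eval n π inp k + c + π (Γ.N + 1)) := by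
  have hJ : (Γ.push a b c j k).J (Γ.N + 1) = j := Function.update_self _ _ _
  have hK : (Γ.push a b c j k).K (Γ.N + 1) = k := Function.update_self _ _ _
  rw [eval_of_lt (by omega) (by omega) (by omega), hJ, hK,
    (extends_push hΓ a b c hj hk).eval_eq π inp j hj,
    (extends_push hΓ a b c hj hk).eval_eq π inp k hk]
  simp only [push, Function.update_self]

theorem exists_read_truncTo (hΓ : Γ.WF n) (hn : n ≤ Γ.N) (h₁ : R₁.idx ≤ Γ.N)
    (h₂ : R₂.idx ≤ Γ.N) {lo hi : ℝ} (hlo : lo < hi) (a b c : ℝ) :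
    ∃ Γ', Extends n Γ Γ' ∧ Γ'.Bounded ⟨Γ.N + 1, hi - lo, lo⟩ ∧ ∀ π inp,
      Γ'.read n ⟨Γ.N + 1, hi - lo, lo⟩ π inp = truncTo lo hi (a * Γ.read n R₁ π inp
        + b * Γ.read n R₂ π inp + c + (hi - lo) * π (Γ.N + 1)) := by
  have hd : hi - lo ≠ 0 := (sub_pos.2 hlo).ne'
  refine ⟨Γ.push (a * R₁.scale / (hi - lo)) (b * R₂.scale / (hi - lo))
    ((a * R₁.shift + b * R₂.shift + c - lo) / (hi - lo)) R₁.idx R₂.idx,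
    extends_push hΓ _ _ _ h₁ h₂, ⟨Nat.le_add_left 1 Γ.N, le_rfl⟩, fun π inp => ?_⟩
  rw [← rescale_truncTo hlo, read]
  simp only [eval_push hΓ hn _ _ _ h₁ h₂]
  congr 3
  simp only [read]
  field_simp
  ring

theorem exists_read_affine (hΓ : Γ.WF n) (hn : n ≤ Γ.N) (h₁ : Γ.Bounded R₁)
    (h₂ : Γ.Bounded R₂) (a b c : ℝ) :
    ∃ Γ' R κ, Extends n Γ Γ' ∧ Γ'.Bounded R ∧ 0 ≤ κ ∧ ∀ π inp,
      |π (Γ.N + 1)| ≤ 1 / 4 → UnitInputs n inp →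
      Γ'.read n R π inp = a * Γ.read n R₁ π inp + b * Γ.read n R₂ π inp + c
        + κ * π (Γ.N + 1) := by
  set B := |a| * (|R₁.scale| + |R₁.shift|) + |b| * (|R₂.scale| + |R₂.shift|) + |c| + 1 with hBdef
  have hB : 0 < B := by positivity
  obtain ⟨Γ', hext, hR', hread⟩ := exists_read_truncTo hΓ hn h₁.2 h₂.2
    (show -(2 * B) < 2 * B by linarith) a b c
  refine ⟨Γ', _, 2 * B - -(2 * B), hext, hR', by linarith,
    fun π inp hπ hinp => ?_⟩
  rw [hread]
  have ha : |a * Γ.read n R₁ π inp| ≤ |a| * (|R₁.scale| + |R₁.shift|) := by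
    rw [abs_mul]; exact mul_le_mul_of_nonneg_left (abs_read_le hinp π h₁.1) (abs_nonneg a)
  have hb : |b * Γ.read n R₂ π inp| ≤ |b| * (|R₂.scale| + |R₂.shift|) := by
    rw [abs_mul]; exact mul_le_mul_of_nonneg_left (abs_read_le hinp π h₂.1) (abs_nonneg b)
  have ha := abs_le.1 ha
  have hb := abs_le.1 hb
  have hc := abs_le.1 (le_refl |c|)
  have hπ := abs_le.1 hπ
  have hl := mul_le_mul_of_nonneg_left hπ.1 hB.le
  have hu := mul_le_mul_of_nonneg_left hπ.2 hB.le
  exact truncTo_of_mem_Icc (by linarith) (by linarith)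

theorem exists_read_posPart (hΓ : Γ.WF n) (hn : n ≤ Γ.N) (h₁ : Γ.Bounded R₁)
    (h₂ : Γ.Bounded R₂) :
    ∃ Γ' R κ, Extends n Γ Γ' ∧ Γ'.Bounded R ∧ 0 ≤ κ ∧ ∀ π inp,
      |π (Γ.N + 1)| ≤ 1 / 4 → UnitInputs n inp →
      Γ'.read n R π inp = max 0 (Γ.read n R₁ π inp - Γ.read n R₂ π inp
        + κ * π (Γ.N + 1)) := by
  set B := |R₁.scale| + |R₁.shift| + (|R₂.scale| + |R₂.shift|) + 1 with hBdef
  have hB : 0 < B := by positivity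
  obtain ⟨Γ', hext, hR', hread⟩ := exists_read_truncTo hΓ hn h₁.2 h₂.2
    (show 0 < 2 * B by linarith) 1 (-1) 0
  refine ⟨Γ', _, 2 * B - 0, hext, hR', by linarith,
    fun π inp hπ hinp => ?_⟩
  rw [hread]
  have ha := abs_le.1 (abs_read_le (Γ := Γ) hinp π h₁.1)
  have hb := abs_le.1 (abs_read_le (Γ := Γ) hinp π h₂.1)
  have hπ := abs_le.1 hπ
  have hu := mul_le_mul_of_nonneg_left hπ.2 hB.le
  rw [truncTo_of_le_hi (by linarith) (by linarith)]
  congr 1; ring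

/-- Every gate applied to readouts can be simulated by appending gates, up to a perturbation of
the gate and a constant offset. -/
theorem exists_read_val (hΓ : Γ.WF n) (hn : n ≤ Γ.N) {m : ℕ} {R : ℕ → Readout}
    (hR : ∀ i ≤ m, Γ.Bounded (R i)) {g : CGate} (hg : g.wf (m + 1)) :
    ∃ Γ' R' κ, Extends n Γ Γ' ∧ Γ'.Bounded R' ∧ 0 ≤ κ ∧
      ∀ δ π, δ ≤ 1 / 4 → (∀ i, |π i| ≤ δ) → ∃ p q, |p| ≤ κ * δ ∧ |q| ≤ κ * δ ∧
        ∀ inp, UnitInputs n inp →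
          Γ'.read n R' π inp = p + g.val q fun i => Γ.read n (R i) π inp := by
  have scaled : ∀ {κ δ x : ℝ}, 0 ≤ κ → |x| ≤ δ → |κ * x| ≤ κ * δ := by
    intro κ δ x hκ hx
    rw [abs_mul, abs_of_nonneg hκ]
    exact mul_le_mul_of_nonneg_left hx hκ
  have affine : ∀ j k, j ≤ m → k ≤ m → ∀ a b c : ℝ,
      (∀ q π inp, g.val q (fun i => Γ.read n (R i) π inp) =
        a * Γ.read n (R j) π inp + b * Γ.read n (R k) π inp + c) →
      ∃ Γ' R' κ, Extends n Γ Γ' ∧ Γ'.Bounded R' ∧ 0 ≤ κ ∧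
        ∀ δ π, δ ≤ 1 / 4 → (∀ i, |π i| ≤ δ) → ∃ p q, |p| ≤ κ * δ ∧ |q| ≤ κ * δ ∧
          ∀ inp, UnitInputs n inp →
            Γ'.read n R' π inp = p + g.val q fun i => Γ.read n (R i) π inp := by
    intro j k hj hk a b c h
    obtain ⟨Γ', R', κ, hext, hR', hκ, hread⟩ := exists_read_affine hΓ hn (hR j hj) (hR k hk) a b c
    refine ⟨Γ', R', κ, hext, hR', hκ, fun δ π hδ hπ => ⟨κ * π (Γ.N + 1), 0, scaled hκ (hπ _), ?_,
      fun inp hinp => ?_⟩⟩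
    · rw [abs_zero]
      exact mul_nonneg hκ ((abs_nonneg _).trans (hπ 0))
    · rw [hread π inp ((hπ _).trans hδ) hinp, h]
      ring
  have posPart : ∀ j₁ j₂ j c, j₁ ≤ m → j₂ ≤ m → j ≤ m →
      ∃ Γ' R' κ, Extends n Γ Γ' ∧ Γ'.Bounded R' ∧ 0 ≤ κ ∧
        ∀ δ π, δ ≤ 1 / 4 → (∀ i, |π i| ≤ δ) → ∃ p q, |p| ≤ κ * δ ∧ |q| ≤ κ * δ ∧
          ∀ inp, UnitInputs n inp → Γ'.read n R' π inp = p + (Γ.read n (R j) π inp +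
            c * max 0 (Γ.read n (R j₁) π inp - Γ.read n (R j₂) π inp + q)) := by
    intro j₁ j₂ j c h₁ h₂ hj
    obtain ⟨Γ₁, R₁, κ₁, hext₁, hR₁, hκ₁, hread₁⟩ :=
      exists_read_posPart hΓ hn (hR j₁ h₁) (hR j₂ h₂)
    obtain ⟨Γ₂, R₂, κ₂, hext₂, hR₂, hκ₂, hread₂⟩ :=
      exists_read_affine hext₁.wf (hn.trans hext₁.le) (hext₁.bounded (hR j hj)) hR₁ 1 c 0
    refine ⟨Γ₂, R₂, κ₁ + κ₂, hext₁.trans hext₂, hR₂, add_nonneg hκ₁ hκ₂, fun δ π hδ hπ =>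
      ⟨κ₂ * π (Γ₁.N + 1), κ₁ * π (Γ.N + 1), ?_, ?_, fun inp hinp => ?_⟩⟩
    · have := mul_nonneg hκ₁ ((abs_nonneg _).trans (hπ 0))
      linarith [scaled hκ₂ (hπ (Γ₁.N + 1))]
    · have := mul_nonneg hκ₂ ((abs_nonneg _).trans (hπ 0))
      linarith [scaled hκ₁ (hπ (Γ.N + 1))]
    · rw [hread₂ π inp ((hπ _).trans hδ) hinp, hread₁ π inp ((hπ _).trans hδ) hinp,
        hext₁.read_eq (hR j hj).2]
      ring
  cases g with
  | add j k =>
    exact affine j k (Nat.le_of_lt_succ hg.1) (Nat.le_of_lt_succ hg.2) 1 1 0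
      fun q π inp => by simp [CGate.val]
  | sub j k =>
    exact affine j k (Nat.le_of_lt_succ hg.1) (Nat.le_of_lt_succ hg.2) 1 (-1) 0
      fun q π inp => by simp [CGate.val, sub_eq_add_neg]
  | const a =>
    exact affine 0 0 (Nat.zero_le m) (Nat.zero_le m) 0 0 a fun q π inp => by simp [CGate.val]
  | smul a j =>
    exact affine j j (Nat.le_of_lt_succ hg) (Nat.le_of_lt_succ hg) a 0 0
      fun q π inp => by simp [CGate.val]
  | cmin j k =>
    have hj := Nat.le_of_lt_succ hg.1
    have hk := Nat.le_of_lt_succ hg.2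
    obtain ⟨Γ', R', κ, hext, hR', hκ, h⟩ := posPart j k j (-1) hj hk hj
    refine ⟨Γ', R', κ, hext, hR', hκ, fun δ π hδ hπ => ?_⟩
    obtain ⟨p, q, hp, hq, hread⟩ := h δ π hδ hπ
    refine ⟨p, -q, hp, by rwa [abs_neg], fun inp hinp => ?_⟩
    rw [hread inp hinp, CGate.val, neg_one_mul, ← min_neg_neg, ← min_add_add_left]
    congr 2 <;> ring
  | cmax j k =>
    have hj := Nat.le_of_lt_succ hg.1
    have hk := Nat.le_of_lt_succ hg.2
    obtain ⟨Γ', R', κ, hext, hR', hκ, h⟩ := posPart k j j 1 hk hj hj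
    refine ⟨Γ', R', κ, hext, hR', hκ, fun δ π hδ hπ => ?_⟩
    obtain ⟨p, q, hp, hq, hread⟩ := h δ π hδ hπ
    refine ⟨p, q, hp, hq, fun inp hinp => ?_⟩
    rw [hread inp hinp, CGate.val, one_mul, ← max_add_add_left]
    congr 2 <;> ring
  | ctr lo hi a b c j k =>
    have hj := Nat.le_of_lt_succ hg.1
    have hk := Nat.le_of_lt_succ hg.2
    rcases le_or_gt hi lo with hlo | hlo
    · exact affine j k hj hk 0 0 hi fun q π inp => by
        simp [CGate.val, truncTo_of_hi_le_lo hlo]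
    · obtain ⟨Γ', hext, hR', hread⟩ :=
        exists_read_truncTo hΓ hn (hR j hj).2 (hR k hk).2 hlo a b c
      have hd : 0 ≤ hi - lo := (sub_pos.2 hlo).le
      refine ⟨Γ', _, hi - lo, hext, hR', hd, fun δ π hδ hπ =>
        ⟨0, (hi - lo) * π (Γ.N + 1), ?_, scaled hd (hπ _), fun inp hinp => ?_⟩⟩
      · rw [abs_zero]
        exact mul_nonneg hd ((abs_nonneg _).trans (hπ 0))
      · rw [hread, zero_add, CGate.val]

end BarCircuit

/-! ### The simulation -/

/-- Some circuit of `[0,1]`-truncation gates simulates the variables `0, …, m` of the general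
circuit with `x₀` clamped to `[-M, M]`: for every small perturbation of the former there is a
small perturbation of the latter whose variables agree with the readouts up to small constant
offsets `e`. -/
def Simulable (n : ℕ) (gate : ℕ → CGate) (M : ℝ) (m : ℕ) : Prop :=
  ∃ (Γ : BarCircuit) (R : ℕ → Readout) (K : ℝ), 4 ≤ K ∧ n ≤ Γ.N ∧ Γ.WF n ∧
    (∀ i ≤ m, Γ.Bounded (R i)) ∧
    ∀ δ π, δ ≤ 1 / K → (∀ i, |π i| ≤ δ) → ∃ σ e : ℕ → ℝ,
      (∀ i, |σ i| ≤ K * δ) ∧ (∀ i, |e i| ≤ K * δ) ∧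
      ∀ inp, UnitInputs n inp → ∀ i ≤ m,
        Γ.read n (R i) π inp = evalC n gate σ (clampZero M (e 0) inp) i + e i

theorem simulable_inputs (n : ℕ) (gate : ℕ → CGate) {M : ℝ} (hM : 0 < M) :
    Simulable n gate M n := by
  have hwf : BarCircuit.WF n ⟨n, 0, 0, 0, 0, 0⟩ := fun i h h' => absurd h' (not_le.2 h)
  obtain ⟨Γ, hext, hR', hread⟩ := BarCircuit.exists_read_truncTo (R₁ := ⟨0, 1, 0⟩)
    (R₂ := ⟨0, 1, 0⟩) hwf le_rfl (Nat.zero_le n) (Nat.zero_le n)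
    (show -M < M by linarith) 1 0 0
  refine ⟨Γ, fun i => if i = 0 then ⟨n + 1, M - -M, -M⟩ else ⟨i, 1, 0⟩, 2 * M + 4, by linarith,
    hext.le, hext.wf, fun i hi => ?_, fun δ π hδ hπ => ?_⟩
  · beta_reduce
    split_ifs with h
    · exact hR'
    · exact ⟨Nat.one_le_iff_ne_zero.2 h, hi.trans hext.le⟩
  have hδ0 : 0 ≤ δ := (abs_nonneg _).trans (hπ 0)
  have hK : 0 ≤ (2 * M + 4) * δ := by positivity
  refine ⟨fun _ => 0, fun i => if i = 0 then 2 * M * π (n + 1) else 0,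
    fun i => by simpa using hK, fun i => ?_, fun inp hinp i hi => ?_⟩
  · beta_reduce
    split_ifs with h
    · rw [abs_mul, abs_of_pos (by linarith)]
      exact mul_le_mul (by linarith) (hπ _) (abs_nonneg _) (by linarith)
    · simpa using hK
  · rw [evalC_of_le hi, clampZero]
    by_cases h : i = 0
    · subst h
      simp only [if_true, hread, Function.update_self, sub_add_cancel]
      simp only [BarCircuit.read, BarCircuit.eval_of_le (Nat.zero_le n)]
      congr 1; ring
    · simp only [if_neg h, Function.update_of_ne h, BarCircuit.read, BarCircuit.eval_of_le hi]
      ring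

theorem Simulable.succ {n N : ℕ} {gate : ℕ → CGate}
    (hwf : ∀ i, n < i → i ≤ N → (gate i).wf i) {M : ℝ} {m : ℕ} (hnm : n ≤ m) (hmN : m + 1 ≤ N)
    (h : Simulable n gate M m) : Simulable n gate M (m + 1) := by
  obtain ⟨Γ, R, K, hK, hn, hΓ, hR, hsim⟩ := h
  have hg := hwf (m + 1) (Nat.lt_succ_of_le hnm) hmN
  obtain ⟨Γ', R', κ, hext, hR', hκ, hval⟩ := BarCircuit.exists_read_val hΓ hn hR hg
  obtain ⟨c, hc, hoff⟩ := (gate (m + 1)).exists_val_add_offset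
  have hKle : K ≤ (c + 1) * (K + κ) := by nlinarith
  refine ⟨Γ', Function.update R (m + 1) R', (c + 1) * (K + κ), hK.trans hKle, hn.trans hext.le,
    hext.wf, fun i hi => ?_, fun δ π hδ hπ => ?_⟩
  · rcases Nat.lt_or_ge m i with h | h
    · obtain rfl : i = m + 1 := le_antisymm hi h
      rwa [Function.update_self]
    · rw [Function.update_of_ne (by omega)]
      exact hext.bounded (hR i h)
  have hδ0 : 0 ≤ δ := (abs_nonneg _).trans (hπ 0)
  have hδK : δ ≤ 1 / K := hδ.trans (one_div_le_one_div_of_le (by linarith) hKle)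
  have hδ4 : δ ≤ 1 / 4 := hδK.trans (one_div_le_one_div_of_le (by norm_num) hK)
  obtain ⟨σ, e, hσ, he, hread⟩ := hsim δ π hδK hπ
  obtain ⟨p, q, hp, hq, hval⟩ := hval δ π hδ4 hπ
  have hKδ : 0 ≤ K * δ := by positivity
  have hκδ : 0 ≤ κ * δ := by positivity
  have hcδ : 0 ≤ c * ((K + κ) * δ) := by positivity
  obtain ⟨s, t, hs, ht, hoff⟩ := hoff ((K + κ) * δ) e q
    (fun i => (he i).trans (by linarith)) (hq.trans (by linarith))
  have hKδle : K * δ ≤ (c + 1) * (K + κ) * δ := mul_le_mul_of_nonneg_right hKle hδ0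
  refine ⟨Function.update σ (m + 1) s, Function.update e (m + 1) (t + p), fun i => ?_, fun i => ?_,
    fun inp hinp i hi => ?_⟩
  · by_cases h : i = m + 1
    · rw [h, Function.update_self]
      linarith
    · rw [Function.update_of_ne h]
      exact (hσ i).trans hKδle
  · by_cases h : i = m + 1
    · rw [h, Function.update_self]
      linarith [abs_add_le t p]
    · rw [Function.update_of_ne h]
      exact (he i).trans hKδle
  have hloc := evalC_congr hwf (σ := Function.update σ (m + 1) s) (σ' := σ)
    (Nat.le_of_succ_le hmN) (fun i hi => Function.update_of_ne (by omega) _ _)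
    (clampZero M (e 0) inp)
  rw [Function.update_of_ne (Nat.succ_ne_zero m).symm]
  rcases Nat.lt_or_ge m i with h | h
  · obtain rfl : i = m + 1 := le_antisymm hi h
    rw [Function.update_self, Function.update_self, hval inp hinp,
      evalC_of_lt (Nat.lt_succ_of_le hnm) hg, Function.update_self,
      CGate.val_congr hg s fun j hj => hloc j (Nat.le_of_lt_succ hj),
      CGate.val_congr hg q fun j hj => hread inp hinp j (Nat.le_of_lt_succ hj), hoff]
    ring
  · have hne : i ≠ m + 1 := by omega
    rw [Function.update_of_ne hne, Function.update_of_ne hne, hext.read_eq (hR i h).2,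
      hread inp hinp i h, hloc i h]

theorem simulable_of_le {n N : ℕ} {gate : ℕ → CGate}
    (hwf : ∀ i, n < i → i ≤ N → (gate i).wf i) {M : ℝ} (hM : 0 < M) {m : ℕ} (hnm : n ≤ m)
    (hmN : m ≤ N) : Simulable n gate M m := by
  induction m, hnm using Nat.le_induction with
  | base => exact simulable_inputs n gate hM
  | succ m hnm ih => exact (ih (Nat.le_of_succ_le hmN)).succ hwf hnm hmN

/-- Reduction of general linear arithmetic circuits to circuits with only `[0,1]`-truncation
gates, respecting perturbations. -/
theorem circuit_reduction (n N : ℕ) (hnN : n < N) (gate : ℕ → CGate)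
    (hwf : ∀ i, n < i → i ≤ N → (gate i).wf i)
    (hout : ∃ a b c j k, gate N = CGate.ctr 0 1 a b c j k) :
    ∃ K' : ℝ, 0 < K' ∧
    ∃ N' : ℕ, n < N' ∧
    ∃ A B C : ℕ → ℝ, ∃ J Kk : ℕ → ℕ,
      (∀ i, n < i → i ≤ N' → J i < i ∧ Kk i < i) ∧
      ∀ δ : ℝ, δ ≤ 1 / K' →
        ∀ π : ℕ → ℝ, (∀ i, |π i| ≤ δ) →
          ∃ σ : ℕ → ℝ, (∀ i, |σ i| ≤ δ * K') ∧
            ∀ inp : ℕ → ℝ, (∀ i, 1 ≤ i → i ≤ n → inp i ∈ Set.Icc (0 : ℝ) 1) →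
              evalC n gate σ inp N = evalBar n A B C J Kk π inp N' := by
  obtain ⟨a, b, c, j, k, hgate⟩ := hout
  have hg := hwf N hnN le_rfl
  have hbound : ∀ σ inp, |evalC n gate σ inp N| ≤ 1 := by
    intro σ inp
    rw [evalC_of_lt hnN hg, hgate, CGate.val, abs_of_nonneg (truncTo_mem_Icc zero_le_one _).1]
    exact (truncTo_mem_Icc zero_le_one _).2
  obtain ⟨M, hM, hclamp⟩ := exists_evalC_clampZero_eq hwf hbound
  obtain ⟨m, rfl⟩ : ∃ m, N = m + 1 := ⟨N - 1, by omega⟩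
  obtain ⟨Γ, R, K, hK, hn, hΓ, hR, hsim⟩ :=
    simulable_of_le hwf hM (Nat.le_of_lt_succ hnN) (Nat.le_succ m)
  obtain ⟨hj, hk⟩ : j < m + 1 ∧ k < m + 1 := by simpa only [hgate, CGate.wf] using hg
  have hj' := Nat.le_of_lt_succ hj
  have hk' := Nat.le_of_lt_succ hk
  obtain ⟨Γ', hext, hR', hread'⟩ :=
    BarCircuit.exists_read_truncTo hΓ hn (hR j hj').2 (hR k hk').2 zero_lt_one a b c
  obtain ⟨-, hN' : Γ.N + 1 ≤ Γ'.N⟩ := hR'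
  have hKle : K ≤ (|a| + |b| + 1) * K := by nlinarith [abs_nonneg a, abs_nonneg b]
  refine ⟨(|a| + |b| + 1) * K, by positivity, Γ.N + 1, by omega, Γ'.A, Γ'.B, Γ'.C, Γ'.J, Γ'.K,
    fun i hi hi' => hext.wf i hi (hi'.trans hN'), fun δ hδ π hπ => ?_⟩
  have hδ0 : 0 ≤ δ := (abs_nonneg _).trans (hπ 0)
  have hδK : δ ≤ 1 / K := hδ.trans (one_div_le_one_div_of_le (by linarith) hKle)
  have hKδ : 0 ≤ K * δ := by positivity
  obtain ⟨σ, e, hσ, he, hread⟩ := hsim δ π hδK hπ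
  have hσ' : ∀ i, |Function.update σ (m + 1) (a * e j + b * e k + π (Γ.N + 1)) i| ≤
      δ * ((|a| + |b| + 1) * K) := by
    intro i
    by_cases h : i = m + 1
    · have h₁ : |a * e j| ≤ |a| * (K * δ) := by
        rw [abs_mul]; exact mul_le_mul_of_nonneg_left (he j) (abs_nonneg a)
      have h₂ : |b * e k| ≤ |b| * (K * δ) := by
        rw [abs_mul]; exact mul_le_mul_of_nonneg_left (he k) (abs_nonneg b)
      rw [h, Function.update_self]
      nlinarith [abs_add_three (a * e j) (b * e k) (π (Γ.N + 1)), hπ (Γ.N + 1)]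
    · rw [Function.update_of_ne h]
      nlinarith [hσ i]
  have hone : δ * ((|a| + |b| + 1) * K) ≤ 1 := (le_div_iff₀ (by positivity)).1 hδ
  have he0 : |e 0| ≤ 1 := (he 0).trans (by rw [mul_comm]; exact (le_div_iff₀ (by positivity)).1 hδK)
  refine ⟨_, hσ', fun inp hinp => ?_⟩
  have hloc := evalC_congr hwf
    (σ := Function.update σ (m + 1) (a * e j + b * e k + π (Γ.N + 1))) (σ' := σ)
    (Nat.le_succ m) (fun i hi => Function.update_of_ne (by omega) _ _) (clampZero M (e 0) inp)
  have hout := hread' π inp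
  rw [hread inp hinp j hj', hread inp hinp k hk', BarCircuit.read, sub_zero, one_mul,
    add_zero] at hout
  change _ = Γ'.eval n π inp (Γ.N + 1)
  rw [hout, ← hclamp _ (fun i => (hσ' i).trans hone) (e 0) he0 inp hinp, evalC_of_lt hnN hg,
    hgate, CGate.val, Function.update_self, hloc j hj', hloc k hk']
  congr 1; ring
end
end
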